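/- Let K be an algebraically closed field of characteristic 0, let d ≥ 5, and let ℓ be an integer with 2 ≤ ℓ ≤ d−1 dividing d−1. If F ∈ K[X,Y,Z] is a nonsingular homogeneous polynomial of degree d such that Aut(F) contains an element of order ℓ(d−1), then F is projectively equivalent to a polynomial of the form X^d + Y^{d−1}·Z + α·X·Z^{d−1} + Σ_k β_k·X^{d−ℓk}·Z^{ℓk}, where α ∈ K^×, β_k ∈ K, and the sum ranges over integers k ≥ 1 with 2 ≤ ℓk ≤ d−2. In particular Aut(F) is cyclic. -/

import Mathlib

open MvPolynomial Matrix

noncomputable section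

variable {K : Type*} [Field K]

/-- The substitution `F ∘ A`, i.e. `X i ↦ ∑ j, A i j • X j`. -/
def substPoly (A : Matrix (Fin 3) (Fin 3) K) (F : MvPolynomial (Fin 3) K) :
    MvPolynomial (Fin 3) K :=
  aeval (fun i => ∑ j, A i j • X j) F

lemma substPoly_one (F : MvPolynomial (Fin 3) K) : substPoly 1 F = F := by
  have h : (fun i => ∑ j, (1 : Matrix (Fin 3) (Fin 3) K) i j • X j)
      = (X : Fin 3 → MvPolynomial (Fin 3) K) := by
    funext i
    simp [Matrix.one_apply, ite_smul]
  rw [substPoly, h]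
  exact aeval_X_left_apply F

lemma substPoly_smul (A : Matrix (Fin 3) (Fin 3) K) (c : K) (F : MvPolynomial (Fin 3) K) :
    substPoly A (c • F) = c • substPoly A F := by
  unfold substPoly
  exact _root_.map_smul (aeval fun i => ∑ j, A i j • X j) c F

lemma substPoly_mul (A B : Matrix (Fin 3) (Fin 3) K) (F : MvPolynomial (Fin 3) K) :
    substPoly (A * B) F = substPoly B (substPoly A F) := by
  have hfun : (fun i => ∑ j, (A * B) i j • (X j : MvPolynomial (Fin 3) K))
      = fun i => (aeval fun i => (∑ j, B i j • X j : MvPolynomial (Fin 3) K))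
          (∑ j, A i j • X j : MvPolynomial (Fin 3) K) := by
    funext i
    rw [map_sum]
    simp only [_root_.map_smul, aeval_X, Matrix.mul_apply, Finset.sum_smul, Finset.smul_sum, smul_smul]
    exact Finset.sum_comm
  have h1 : substPoly (A * B) F
      = aeval (fun i => (aeval fun i => (∑ j, B i j • X j : MvPolynomial (Fin 3) K))
          (∑ j, A i j • X j : MvPolynomial (Fin 3) K)) F := by
    unfold substPoly
    exact congrArg
      (fun f => (aeval f : MvPolynomial (Fin 3) K →ₐ[K] MvPolynomial (Fin 3) K) F) hfun
  rw [h1, ← MvPolynomial.comp_aeval]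
  rfl

/-- The subgroup of `GL₃(K)` preserving the polynomial `F` up to scalar. -/
def autGL (F : MvPolynomial (Fin 3) K) : Subgroup (GL (Fin 3) K) where
  carrier := {A | ∃ c : Kˣ, substPoly (A : Matrix (Fin 3) (Fin 3) K) F = (c : K) • F}
  one_mem' := ⟨1, by simp [substPoly_one]⟩
  mul_mem' := by
    rintro A B ⟨c, hc⟩ ⟨e, he⟩
    refine ⟨c * e, ?_⟩
    have hAB : ((A * B : GL (Fin 3) K) : Matrix (Fin 3) (Fin 3) K)
        = (A : Matrix (Fin 3) (Fin 3) K) * (B : Matrix (Fin 3) (Fin 3) K) := rfl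
    rw [hAB, substPoly_mul, hc, substPoly_smul, he, smul_smul, ← Units.val_mul]
  inv_mem' := by
    rintro A ⟨c, hc⟩
    refine ⟨c⁻¹, ?_⟩
    have key : (c : K) • substPoly ((A⁻¹ : GL (Fin 3) K) : Matrix (Fin 3) (Fin 3) K) F = F := by
      rw [← substPoly_smul, ← hc, ← substPoly_mul]
      have h1 : (A : Matrix (Fin 3) (Fin 3) K) *
          ((A⁻¹ : GL (Fin 3) K) : Matrix (Fin 3) (Fin 3) K) = 1 := by
        exact_mod_cast Units.mul_inv A
      rw [h1, substPoly_one]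
    calc substPoly ((A⁻¹ : GL (Fin 3) K) : Matrix (Fin 3) (Fin 3) K) F
        = ((c : K)⁻¹ * (c : K)) •
            substPoly ((A⁻¹ : GL (Fin 3) K) : Matrix (Fin 3) (Fin 3) K) F := by
          rw [inv_mul_cancel₀ (Units.ne_zero c), one_smul]
      _ = (c : K)⁻¹ • ((c : K) •
            substPoly ((A⁻¹ : GL (Fin 3) K) : Matrix (Fin 3) (Fin 3) K) F) := by
          rw [smul_smul]
      _ = (c : K)⁻¹ • F := by rw [key]
      _ = ((c⁻¹ : Kˣ) : K) • F := by rw [Units.val_inv_eq_inv_val]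

/-- `PGL₃(K)`: the quotient of `GL₃(K)` by its center (the scalar matrices). -/
abbrev PGL3 (K : Type*) [Field K] := GL (Fin 3) K ⧸ Subgroup.center (GL (Fin 3) K)

/-- The automorphism group of the plane curve `F = 0`, as a subgroup of `PGL₃(K)`:
the classes of matrices `A` with `F ∘ A = λ • F` for some `λ ∈ Kˣ`. -/
def projAut (F : MvPolynomial (Fin 3) K) : Subgroup (PGL3 K) :=
  (autGL F).map (QuotientGroup.mk' (Subgroup.center (GL (Fin 3) K)))

/-- `F` is nonsingular: the only common zero of its partial derivatives is the origin. -/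
def IsNonsingular (F : MvPolynomial (Fin 3) K) : Prop :=
  ∀ x : Fin 3 → K, (∀ i, eval x (pderiv i F) = 0) → x = 0

/-- `F` and `G` are projectively equivalent: `F ∘ A = λ • G` for some `A ∈ GL₃(K)`, `λ ∈ Kˣ`. -/
def ProjEquiv (F G : MvPolynomial (Fin 3) K) : Prop :=
  ∃ A : GL (Fin 3) K, ∃ c : Kˣ,
    substPoly (A : Matrix (Fin 3) (Fin 3) K) F = (c : K) • G


section General

lemma pderiv_substPoly (B : Matrix (Fin 3) (Fin 3) K) (G : MvPolynomial (Fin 3) K) (i : Fin 3) :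
    pderiv i (substPoly B G) = ∑ j, C (B j i) * substPoly B (pderiv j G) := by
  induction G using MvPolynomial.induction_on with
  | C a => simp [substPoly, aeval_C]
  | add p q hp hq =>
    have h : ∀ p q, substPoly B (p + q) = substPoly B p + substPoly B q := fun p q => by
      simp [substPoly]
    simp only [h, map_add, hp, hq, mul_add, Finset.sum_add_distrib]
  | mul_X p k hp =>
    have h : ∀ p q, substPoly B (p * q) = substPoly B p * substPoly B q := fun p q => by
      simp [substPoly]
    have ha : ∀ p q, substPoly B (p + q) = substPoly B p + substPoly B q := fun p q => by
      simp [substPoly]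
    have hX : substPoly B (X k) = ∑ j, C (B k j) * X j := by
      simp [substPoly, smul_eq_C_mul]
    have hX' : pderiv i (substPoly B (X k)) = C (B k i) := by
      rw [hX]
      fin_cases i <;> simp [Fin.sum_univ_three, pderiv_X, Pi.single_apply]
    have h0 : ∀ j, substPoly B (pderiv j (X k)) = if j = k then 1 else 0 := by
      intro j
      rw [pderiv_X]
      by_cases hjk : j = k
      · subst hjk; simp [substPoly]
      · simp [substPoly, hjk, Pi.single_apply, Ne.symm hjk, eq_comm]
    rw [h, pderiv_mul, hp, hX']
    simp only [pderiv_mul, ha, h, h0, mul_add, Finset.sum_add_distrib]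
    congr 1
    · rw [Finset.sum_mul]; exact Finset.sum_congr rfl fun _ _ => by ring
    · simp [mul_comm]

lemma eval_substPoly (B : Matrix (Fin 3) (Fin 3) K) (G : MvPolynomial (Fin 3) K) (x : Fin 3 → K) :
    eval x (substPoly B G) = eval (B *ᵥ x) G := by
  have : (eval x).comp ((aeval (fun i => ∑ j, B i j • X j) :
      MvPolynomial (Fin 3) K →ₐ[K] MvPolynomial (Fin 3) K) : _ →+* _) = eval (B *ᵥ x) := by
    apply MvPolynomial.ringHom_ext
    · intro r; simp
    · intro i; simp [Matrix.mulVec, dotProduct, smul_eval]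
  exact congrArg (fun f => f G) this

lemma pderiv_comm' (i j : Fin 3) (G : MvPolynomial (Fin 3) K) :
    pderiv i (pderiv j G) = pderiv j (pderiv i G) := by
  induction G using MvPolynomial.induction_on with
  | C a => simp
  | add p q hp hq => simp [hp, hq]
  | mul_X p k hp =>
    have h0 : ∀ i j, pderiv i (pderiv j (X k : MvPolynomial (Fin 3) K)) = 0 := by
      intro i j
      rw [pderiv_X]
      by_cases hjk : j = k
      · subst hjk; simp
      · simp [hjk, Pi.single_apply]
    simp only [pderiv_mul, map_add, h0, hp]
    ring

lemma nonsing_subst (P : GL (Fin 3) K) (F : MvPolynomial (Fin 3) K) (h : IsNonsingular F) :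
    IsNonsingular (substPoly (P : Matrix (Fin 3) (Fin 3) K) F) := by
  intro x hx
  have h1 : ((P : Matrix (Fin 3) (Fin 3) K)ᵀ *ᵥ fun j => eval ((P : Matrix (Fin 3) (Fin 3) K) *ᵥ x)
      (pderiv j F)) = 0 := by
    funext i
    have := hx i
    rw [pderiv_substPoly] at this
    simpa [eval_substPoly, Matrix.mulVec, dotProduct] using this
  have hdet : IsUnit (P : Matrix (Fin 3) (Fin 3) K).det :=
    (Matrix.isUnit_iff_isUnit_det _).1 P.isUnit
  have h2 := Matrix.eq_zero_of_mulVec_eq_zero (by rw [det_transpose]; exact hdet.ne_zero) h1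
  have h3 := h _ (fun i => congrFun h2 i)
  exact Matrix.eq_zero_of_mulVec_eq_zero hdet.ne_zero h3

lemma homog_subst (P : Matrix (Fin 3) (Fin 3) K) (F : MvPolynomial (Fin 3) K) (d : ℕ)
    (h : F.IsHomogeneous d) : (substPoly P F).IsHomogeneous d := by
  have := h.aeval (n := 1) (fun i => ∑ j, P i j • X j : Fin 3 → MvPolynomial (Fin 3) K) (by
    intro i
    apply IsHomogeneous.sum
    intro j _
    rw [smul_eq_C_mul]
    exact (isHomogeneous_C_mul_X _ _))
  simpa [substPoly] using this

lemma coeff_subst_diag (a : Fin 3 → K) (G : MvPolynomial (Fin 3) K) (m : Fin 3 →₀ ℕ) :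
    coeff m (substPoly (Matrix.diagonal a) G) = (∏ i, a i ^ m i) * coeff m G := by
  have hf : (fun i => ∑ j, (Matrix.diagonal a) i j • (X j : MvPolynomial (Fin 3) K))
      = fun i => C (a i) * X i := by
    funext i
    simp [Matrix.diagonal_apply, ite_smul, smul_eq_C_mul]
  rw [substPoly, hf]
  induction G using MvPolynomial.induction_on' with
  | monomial u r =>
    have : aeval (fun i => C (a i) * X i) (monomial u r) = monomial u ((∏ i, a i ^ u i) * r) := by
      rw [aeval_monomial, Finsupp.prod_fintype _ _ (by simp), monomial_eq,
        Finsupp.prod_fintype _ _ (by simp)]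
      simp only [mul_pow, Finset.prod_mul_distrib, map_mul, map_prod, map_pow]
      simp [algebraMap_eq]
      ring
    rw [this]
    simp only [coeff_monomial]
    split_ifs with hum
    · rw [hum]
    · simp
  | add p q hp hq => rw [map_add, coeff_add, hp, hq, coeff_add, mul_add]

/-- the exponent of the monomial `x_i^e x_j` -/
def mon (e : ℕ) (i j : Fin 3) : Fin 3 →₀ ℕ := Finsupp.single i e + Finsupp.single j 1

lemma exists_mon (G : MvPolynomial (Fin 3) K) (e : ℕ) (h : G.IsHomogeneous (e + 1))
    (hns : IsNonsingular G) (i : Fin 3) : ∃ j, coeff (mon e i j) G ≠ 0 := by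
  by_contra! hc
  have h1 := hns (Pi.single i 1) (by
    intro j
    rw [eval_eq']
    apply Finset.sum_eq_zero
    intro m hm
    rw [mem_support_iff, coeff_pderiv] at hm
    by_cases hmi : ∀ k, k ≠ i → m k = 0
    · exfalso
      apply hm
      have hmm : m = Finsupp.single i (m i) := by
        ext k
        by_cases hk : k = i
        · subst hk; simp
        · rw [hmi k hk]; simp [Finsupp.single_apply, Ne.symm hk]
      by_cases hme : m i = e
      · rw [hmm, hme]
        have := hc j
        rw [mon] at this
        rw [this]; simp
      · rw [h.coeff_eq_zero]
        · simp
        · rw [hmm]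
          simp [map_add, hme]
    · push Not at hmi
      obtain ⟨k, hk, hmk⟩ := hmi
      rw [Finset.prod_eq_zero (Finset.mem_univ k), mul_zero]
      simp [Pi.single_apply, hk, hmk])
  have := congrFun h1 i
  simp at this

end General
section Rigidity

/-- If `Y^k L = N^2 R` with `L` linear and `N` a linear form not proportional to `Y`, `L = 0`. -/
lemma linear_eq_zero (k : ℕ) (l n : Fin 3 → K) (R : MvPolynomial (Fin 3) K)
    (h : X 1 ^ k * (∑ i, C (l i) * X i) = (∑ i, C (n i) * X i) ^ 2 * R)
    (p : Fin 3 → K) (hp : p 1 = 1) (hn : ∑ i, n i * p i = 0) : l = 0 := by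
  have key : ∀ q : Fin 3 → K, ∑ i, l i * q i = 0 := by
    intro q
    let φ : MvPolynomial (Fin 3) K →ₐ[K] Polynomial K :=
      aeval fun i => Polynomial.C (p i) + Polynomial.X * Polynomial.C (q i)
    have h1 := congrArg φ h
    have hlin : ∀ c : Fin 3 → K, φ (∑ i, C (c i) * X i) =
        Polynomial.C (∑ i, c i * p i) + Polynomial.C (∑ i, c i * q i) * Polynomial.X := by
      intro c
      simp only [φ, Fin.sum_univ_three, map_add, map_mul, aeval_X, aeval_C, Polynomial.algebraMap_eq]
      ring
    rw [map_mul, map_mul, map_pow, map_pow, hlin, hlin, hn] at h1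
    have hX : φ (X 1) = Polynomial.C 1 + Polynomial.X * Polynomial.C (q 1) := by
      simp [φ, hp]
    rw [hX] at h1
    have hdvd : (Polynomial.X : Polynomial K) ^ 2 ∣
        (Polynomial.C 1 + Polynomial.X * Polynomial.C (q 1)) ^ k *
        (Polynomial.C (∑ i, l i * p i) + Polynomial.C (∑ i, l i * q i) * Polynomial.X) := by
      rw [h1]
      refine ⟨Polynomial.C (∑ i, n i * q i) ^ 2 * φ R, ?_⟩
      simp only [map_zero]
      ring
    have hcop : IsCoprime ((Polynomial.X : Polynomial K) ^ 2)
        ((Polynomial.C 1 + Polynomial.X * Polynomial.C (q 1)) ^ k) := by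
      apply IsCoprime.pow
      refine ⟨-Polynomial.C (q 1), 1, ?_⟩
      simp only [map_one]
      ring
    have h2 := hcop.dvd_of_dvd_mul_left hdvd
    rw [Polynomial.X_pow_dvd_iff] at h2
    have h3 := h2 1 (by norm_num)
    simpa using h3
  funext i
  have := key (Pi.single i 1)
  simpa [Pi.single_apply] using this

lemma rigid [CharZero K] (d : ℕ) (hd : 5 ≤ d) (α : K) (hα : α ≠ 0)
    (G : MvPolynomial (Fin 3) K)
    (h1 : pderiv 1 G = C ((d - 1 : ℕ) : K) * (X 1 ^ (d - 2) * X 2))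
    (hx : ∀ x : K, eval ![x, 0, 0] G = x ^ d)
    (hyz : ∀ y z : K, eval ![0, y, z] G = y ^ (d - 1) * z)
    (h0x : ∀ x : K, eval ![x, 0, 0] (pderiv 0 G) = d * x ^ (d - 1))
    (h2x : ∀ x : K, eval ![x, 0, 0] (pderiv 2 G) = 0)
    (h0z : ∀ z : K, eval ![0, 0, z] (pderiv 0 G) = α * z ^ (d - 1))
    (B : GL (Fin 3) K) (t : Kˣ)
    (hB : substPoly (B : Matrix (Fin 3) (Fin 3) K) G = (t : K) • G) :
    ∃ a e c : K, (B : Matrix (Fin 3) (Fin 3) K) = Matrix.diagonal ![a, e, c] ∧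
      a ^ d = t ∧ e ^ (d - 1) * c = t ∧ a * c ^ (d - 1) = t := by
  obtain ⟨f, rfl⟩ : ∃ f, d = f + 5 := ⟨d - 5, by omega⟩
  simp only [show f + 5 - 1 = f + 4 from rfl, show f + 5 - 2 = f + 3 from rfl] at *
  have hf4 : ((f + 4 : ℕ) : K) ≠ 0 := Nat.cast_ne_zero.2 (by omega)
  set M : Matrix (Fin 3) (Fin 3) K := (B : Matrix (Fin 3) (Fin 3) K) with hM
  set N : Matrix (Fin 3) (Fin 3) K := ((B⁻¹ : GL (Fin 3) K) : Matrix (Fin 3) (Fin 3) K) with hN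
  have hMN : M * N = 1 := by
    rw [hM, hN]; exact_mod_cast Units.mul_inv B
  have hNM : N * M = 1 := by
    rw [hM, hN]; exact_mod_cast Units.inv_mul B
  have ht : (t : K) ≠ 0 := t.ne_zero
  -- chain rule
  have chain : ∀ i x, ∑ j, M j i * eval (M *ᵥ x) (pderiv j G) = t * eval x (pderiv i G) := by
    intro i x
    have := congrArg (fun p => eval x (pderiv i p)) hB
    simp only [pderiv_substPoly] at this
    simpa [eval_substPoly, smul_eval] using this
  have hGM : ∀ x, eval (M *ᵥ x) G = t * eval x G := by
    intro x
    rw [← eval_substPoly, hB, smul_eval]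
  have hcol : eval ![M 0 1, M 1 1, M 2 1] G = 0 := by
    have h := hGM ![0, 1, 0]
    have h' := hyz 1 0
    rw [h'] at h
    have e : M *ᵥ ![0, 1, 0] = ![M 0 1, M 1 1, M 2 1] := by
      funext i; fin_cases i <;> simp [Matrix.mulVec, dotProduct, Fin.sum_univ_three]
    rw [e] at h
    simpa using h
  have hNM1 : ∀ j, N 1 0 * M 0 j + N 1 1 * M 1 j + N 1 2 * M 2 j = if j = 1 then 1 else 0 := by
    intro j
    have := congrFun (congrFun hNM 1) j
    rw [Matrix.mul_apply, Fin.sum_univ_three] at this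
    rw [this, Matrix.one_apply]
    simp [eq_comm]
  -- directional derivative along the second column
  have hD : ∑ j, C (M j 1) * pderiv j G =
      C (t * ((f + 4 : ℕ) : K)) * ((∑ i, C (N 1 i) * X i) ^ (f + 3) * ∑ i, C (N 2 i) * X i) := by
    have h := congrArg (fun p => substPoly N (pderiv 1 p)) hB
    simp only [pderiv_substPoly] at h
    have hadd : ∀ s : Fin 3 → MvPolynomial (Fin 3) K,
        substPoly N (∑ j, C (M j 1) * s j) = ∑ j, C (M j 1) * substPoly N (s j) := by
      intro s
      simp [substPoly, map_sum]
    rw [hadd] at h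
    simp only [← substPoly_mul, hMN, substPoly_one] at h
    rw [h, smul_eq_C_mul, pderiv_C_mul, h1]
    simp [substPoly, smul_eq_C_mul, mul_assoc]
  have hD1 := congrArg (pderiv 1) hD
  have hL : (∑ i, C (M i 1) * pderiv i (pderiv 1 G)) =
      pderiv 1 (∑ j, C (M j 1) * pderiv j G) := by
    rw [map_sum]
    exact Finset.sum_congr rfl fun i _ => by rw [pderiv_C_mul, pderiv_comm']
  rw [← hL, h1] at hD1
  have hlin : ∃ R, X 1 ^ (f + 2) * (∑ i, C ((![0, (f + 4 : ℕ) * M 2 1,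
      (f + 4 : ℕ) * ((f + 3 : ℕ) * M 1 1)] : Fin 3 → K) i) * X i) =
      (∑ i, C (N 1 i) * X i) ^ 2 * R := by
    refine ⟨C (t * ((f + 4 : ℕ) : K)) * ((∑ i, C (N 1 i) * X i) ^ f *
      (((f + 3 : ℕ) : MvPolynomial (Fin 3) K) * C (N 1 1) * (∑ i, C (N 2 i) * X i)
        + (∑ i, C (N 1 i) * X i) * C (N 2 1))), ?_⟩
    have hp : ∀ r, pderiv 1 (∑ i, C (N r i) * X i) = C (N r 1) := by
      intro r
      simp [Fin.sum_univ_three, pderiv_X]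
    rw [pderiv_C_mul, pderiv_mul, pderiv_pow, hp, hp] at hD1
    have e1 : ∑ i, C (M i 1) * pderiv i (C ((f + 4 : ℕ) : K) * (X 1 ^ (f + 3) * X 2)) =
      X 1 ^ (f + 2) * (∑ i, C ((![0, (f + 4 : ℕ) * M 2 1,
      (f + 4 : ℕ) * ((f + 3 : ℕ) * M 1 1)] : Fin 3 → K) i) * X i) := by
      simp only [Fin.sum_univ_three, pderiv_C_mul, pderiv_mul, pderiv_pow, pderiv_X]
      simp [show (C (3 : K) : MvPolynomial (Fin 3) K) = 3 from map_ofNat C 3]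
      ring
    rw [← e1, hD1]
    rw [show f + 3 - 1 = f + 2 from rfl]
    ring
  obtain ⟨R, hR⟩ := hlin
  have hnop : ∀ p : Fin 3 → K, p 1 = 1 → ∑ i, N 1 i * p i ≠ 0 := by
    intro p hp hn
    have hl := linear_eq_zero _ _ _ _ hR p hp hn
    have hf3 : ((f + 3 : ℕ) : K) ≠ 0 := Nat.cast_ne_zero.2 (by omega)
    have hl1 : M 2 1 = 0 := by
      have := congrFun hl 1
      simp only [Matrix.cons_val_one, Matrix.cons_val_zero, Pi.zero_apply, mul_eq_zero] at this
      exact this.resolve_left hf4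
    have hl2 : M 1 1 = 0 := by
      have : ((f + 4 : ℕ) : K) * ((f + 3 : ℕ) * M 1 1) = 0 := congrFun hl 2
      simp only [mul_eq_zero] at this
      exact (this.resolve_left hf4).resolve_left hf3
    rw [hl1, hl2, hx] at hcol
    have hl0 : M 0 1 = 0 := by simpa using hcol
    have := hNM1 1
    simp [hl0, hl1, hl2] at this
  have hN10 : N 1 0 = 0 := by
    by_contra hne
    apply hnop ![-(N 1 1) / N 1 0, 1, 0] (by simp)
    simp [Fin.sum_univ_three]
    field_simp
    ring
  have hN12 : N 1 2 = 0 := by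
    by_contra hne
    apply hnop ![0, 1, -(N 1 1) / N 1 2] (by simp)
    simp [Fin.sum_univ_three]
    field_simp
    ring
  simp only [hN10, hN12, zero_mul, zero_add, add_zero] at hNM1
  have hN11 : N 1 1 ≠ 0 := by
    intro h0
    have := hNM1 1
    simp [h0] at this
  have hM10 : M 1 0 = 0 := by
    have := hNM1 0
    simpa [hN11] using this
  have hM12 : M 1 2 = 0 := by
    have := hNM1 2
    simpa [hN11] using this
  have hM11 : M 1 1 ≠ 0 := by
    intro h0
    have := hNM1 1
    simp [h0] at this
  -- second column
  have hM01 : M 0 1 = 0 := by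
    have := congrArg (eval ![1, 0, 0]) hD
    simp [Fin.sum_univ_three, h0x, h2x, h1, hN10] at this
    rcases this with h | h
    · exact h
    · exfalso
      have : ((f + 5 : ℕ) : K) ≠ 0 := Nat.cast_ne_zero.2 (by omega)
      exact this (by exact_mod_cast h)
  have hM21 : M 2 1 = 0 := by
    rw [hM01, hyz] at hcol
    simpa [hM11] using hcol
  -- relation from the derivative in the second variable
  have hrel : ∀ x : Fin 3 → K, M 1 1 * ((M 1 1 * x 1) ^ (f + 3) * (M 2 0 * x 0 + M 2 2 * x 2))
      = t * (x 1 ^ (f + 3) * x 2) := by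
    intro x
    have h := chain 1 x
    rw [Fin.sum_univ_three, hM01, hM21, h1] at h
    have e1 : (M *ᵥ x) 1 = M 1 1 * x 1 := by
      simp [Matrix.mulVec, dotProduct, Fin.sum_univ_three, hM10, hM12]
    have e2 : (M *ᵥ x) 2 = M 2 0 * x 0 + M 2 2 * x 2 := by
      simp [Matrix.mulVec, dotProduct, Fin.sum_univ_three, hM21]
    simp only [map_mul, map_pow, eval_X, eval_C, e1, e2] at h
    apply mul_left_cancel₀ hf4
    linear_combination h
  have hM20 : M 2 0 = 0 := by
    have := hrel ![1, 1, 0]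
    simpa [hM11] using this
  have hec : M 1 1 ^ (f + 4) * M 2 2 = t := by
    have := hrel ![0, 1, 1]
    simp at this
    rw [← this]; ring
  have haa : M 0 0 ^ (f + 5) = t := by
    have h := hGM ![1, 0, 0]
    have e : M *ᵥ ![1, 0, 0] = ![M 0 0, 0, 0] := by
      funext i; fin_cases i <;>
        simp [Matrix.mulVec, dotProduct, Fin.sum_univ_three, hM10, hM20]
    rw [e, hx, hx] at h
    simpa using h
  have ha0 : M 0 0 ≠ 0 := by
    intro h0
    rw [h0] at haa
    apply ht
    rw [← haa]; simp
  have hM02 : M 0 2 = 0 := by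
    have h := chain 2 ![1, 0, 0]
    have e : M *ᵥ ![1, 0, 0] = ![M 0 0, 0, 0] := by
      funext i; fin_cases i <;>
        simp [Matrix.mulVec, dotProduct, Fin.sum_univ_three, hM10, hM20]
    rw [e, Fin.sum_univ_three, h0x, h2x, h2x, hM12] at h
    have h5 : ((f + 5 : ℕ) : K) ≠ 0 := Nat.cast_ne_zero.2 (by omega)
    have h' : M 0 2 * (((f + 5 : ℕ) : K) * M 0 0 ^ (f + 4)) = 0 := by
      linear_combination h
    rcases mul_eq_zero.1 h' with h' | h'
    · exact h'
    · exact absurd h' (mul_ne_zero h5 (pow_ne_zero _ ha0))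
  have hac : M 0 0 * M 2 2 ^ (f + 4) = t := by
    have h := chain 0 ![0, 0, 1]
    have e : M *ᵥ ![0, 0, 1] = ![0, 0, M 2 2] := by
      funext i; fin_cases i <;>
        simp [Matrix.mulVec, dotProduct, Fin.sum_univ_three, hM02, hM12]
    rw [e, Fin.sum_univ_three, hM10, hM20, h0z, h0z] at h
    apply mul_left_cancel₀ hα
    linear_combination h
  refine ⟨M 0 0, M 1 1, M 2 2, ?_, haa, hec, hac⟩
  ext i j
  fin_cases i <;> fin_cases j <;> simp [hM01, hM02, hM10, hM12, hM20, hM21]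

end Rigidity
section NormalForm

/-- the normal form -/
def nf (d ℓ : ℕ) (α : K) (β : ℕ → K) : MvPolynomial (Fin 3) K :=
  X 0 ^ d + X 1 ^ (d - 1) * X 2 + C α * X 0 * X 2 ^ (d - 1) +
        ∑ k ∈ (Finset.Icc 1 d).filter (fun k => 2 ≤ ℓ * k ∧ ℓ * k ≤ d - 2),
          C (β k) * X 0 ^ (d - ℓ * k) * X 2 ^ (ℓ * k)

lemma nf_rigid [CharZero K] (d ℓ : ℕ) (hd : 5 ≤ d) (α : K) (hα : α ≠ 0) (β : ℕ → K)
    (B : GL (Fin 3) K) (t : Kˣ)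
    (hB : substPoly (B : Matrix (Fin 3) (Fin 3) K) (nf d ℓ α β) = (t : K) • nf d ℓ α β) :
    ∃ a e c : K, (B : Matrix (Fin 3) (Fin 3) K) = Matrix.diagonal ![a, e, c] ∧
      a ^ d = t ∧ e ^ (d - 1) * c = t ∧ a * c ^ (d - 1) = t := by
  have hmem : ∀ k ∈ (Finset.Icc 1 d).filter (fun k => 2 ≤ ℓ * k ∧ ℓ * k ≤ d - 2),
      ℓ * k ≠ 0 ∧ ℓ * k - 1 ≠ 0 ∧ d - ℓ * k ≠ 0 ∧ d - ℓ * k - 1 ≠ 0 := by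
    intro k hk
    simp only [Finset.mem_filter] at hk
    omega
  have hd0 : d ≠ 0 := by omega
  have hd1 : d - 1 ≠ 0 := by omega
  have hd2 : d - 1 - 1 ≠ 0 := by omega
  refine rigid d hd α hα (nf d ℓ α β) ?_ ?_ ?_ ?_ ?_ ?_ B t hB
  · simp [nf, pderiv_mul, pderiv_pow, pderiv_X, show d - 1 - 1 = d - 2 by omega]
    ring
  · intro x
    have : ∑ k ∈ (Finset.Icc 1 d).filter (fun k => 2 ≤ ℓ * k ∧ ℓ * k ≤ d - 2),
        β k * x ^ (d - ℓ * k) * 0 ^ (ℓ * k) = 0 :=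
      Finset.sum_eq_zero fun k hk => by simp [hmem k hk]
    simp [nf, hd1, this]
  · intro y z
    have : ∑ k ∈ (Finset.Icc 1 d).filter (fun k => 2 ≤ ℓ * k ∧ ℓ * k ≤ d - 2),
        β k * 0 ^ (d - ℓ * k) * z ^ (ℓ * k) = 0 :=
      Finset.sum_eq_zero fun k hk => by simp [hmem k hk]
    simp [nf, hd0, this]
  · intro x
    simp only [nf, map_add, map_sum]
    rw [Finset.sum_eq_zero]
    · simp [pderiv_mul, pderiv_pow, pderiv_X, hd1]
    · intro k hk
      simp [pderiv_mul, pderiv_pow, pderiv_X, hmem k hk]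
  · intro x
    simp only [nf, map_add, map_sum]
    rw [Finset.sum_eq_zero]
    · simp [pderiv_mul, pderiv_pow, pderiv_X, hd1, hd2]
    · intro k hk
      simp [pderiv_mul, pderiv_pow, pderiv_X, hmem k hk]
  · intro x
    simp only [nf, map_add, map_sum]
    rw [Finset.sum_eq_zero]
    · simp [pderiv_mul, pderiv_pow, pderiv_X, hd1, hd2]
      ring
    · intro k hk
      simp [pderiv_mul, pderiv_pow, pderiv_X, hmem k hk]

/-- exponent vectors -/
def ex (i j k : ℕ) : Fin 3 →₀ ℕ := Finsupp.single 0 i + Finsupp.single 1 j + Finsupp.single 2 k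

@[simp] lemma ex0 (i j k : ℕ) : ex i j k 0 = i := by simp [ex]
@[simp] lemma ex1 (i j k : ℕ) : ex i j k 1 = j := by simp [ex]
@[simp] lemma ex2 (i j k : ℕ) : ex i j k 2 = k := by simp [ex]

lemma ex_self (m : Fin 3 →₀ ℕ) : ex (m 0) (m 1) (m 2) = m := by
  ext i; fin_cases i <;> simp

lemma ex_eq_iff (i j k : ℕ) (m : Fin 3 →₀ ℕ) : ex i j k = m ↔ i = m 0 ∧ j = m 1 ∧ k = m 2 := by
  constructor
  · rintro rfl; simp
  · rintro ⟨rfl, rfl, rfl⟩; exact ex_self m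

lemma ex_monomial (c : K) (i j k : ℕ) :
    C c * X 0 ^ i * X 1 ^ j * X 2 ^ k = (monomial (ex i j k) c : MvPolynomial (Fin 3) K) := by
  rw [monomial_eq, Finsupp.prod_fintype _ _ (by simp)]
  simp [Fin.prod_univ_three, mul_assoc]

lemma coeff_nf (d ℓ : ℕ) (α : K) (β : ℕ → K) (m : Fin 3 →₀ ℕ) :
    coeff m (nf d ℓ α β) = (if ex d 0 0 = m then 1 else 0) + (if ex 0 (d - 1) 1 = m then 1 else 0)
      + (if ex 1 0 (d - 1) = m then α else 0)
      + ∑ k ∈ (Finset.Icc 1 d).filter (fun k => 2 ≤ ℓ * k ∧ ℓ * k ≤ d - 2),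
          if ex (d - ℓ * k) 0 (ℓ * k) = m then β k else 0 := by
  have e : nf d ℓ α β = monomial (ex d 0 0) 1 + monomial (ex 0 (d - 1) 1) 1
      + monomial (ex 1 0 (d - 1)) α +
      ∑ k ∈ (Finset.Icc 1 d).filter (fun k => 2 ≤ ℓ * k ∧ ℓ * k ≤ d - 2),
        monomial (ex (d - ℓ * k) 0 (ℓ * k)) (β k) := by
    simp only [nf, ← ex_monomial]
    simp
  rw [e]
  simp only [coeff_add, coeff_sum, coeff_monomial]

lemma eq_nf (d ℓ : ℕ) (hd : 5 ≤ d) (hℓ1 : 2 ≤ ℓ) (hdvd : ℓ ∣ d - 1)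
    (G : MvPolynomial (Fin 3) K) (hG : G.IsHomogeneous d)
    (hs : ∀ m, coeff m G ≠ 0 → (m 1 = 0 ∧ ℓ ∣ m 2) ∨ (m 1 = d - 1 ∧ m 2 = 1))
    (hx : coeff (ex d 0 0) G = 1) (hy : coeff (ex 0 (d - 1) 1) G = 1) :
    G = nf d ℓ (coeff (ex 1 0 (d - 1)) G) (fun k => coeff (ex (d - ℓ * k) 0 (ℓ * k)) G) := by
  ext m
  rw [coeff_nf]
  by_cases h4 : ∃ k ∈ (Finset.Icc 1 d).filter (fun k => 2 ≤ ℓ * k ∧ ℓ * k ≤ d - 2),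
      ex (d - ℓ * k) 0 (ℓ * k) = m
  · obtain ⟨k, hk, rfl⟩ := h4
    rw [Finset.sum_eq_single k]
    · have hk' := (Finset.mem_filter.1 hk).2
      simp only [ex_eq_iff, ex0, ex1, ex2]
      rw [if_neg (by omega), if_neg (by omega), if_neg (by omega), if_pos (by simp)]
      simp
    · intro k' _ hne
      rw [if_neg]
      rw [ex_eq_iff]
      simp only [ex2]
      rintro ⟨-, -, h⟩
      exact hne (Nat.eq_of_mul_eq_mul_left (by omega) h)
    · intro h; exact absurd hk h
  · rw [Finset.sum_eq_zero (s := (Finset.Icc 1 d).filter (fun k => 2 ≤ ℓ * k ∧ ℓ * k ≤ d - 2))]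
    swap
    · intro k hk
      rw [if_neg]
      intro h
      exact h4 ⟨k, hk, h⟩
    by_cases h1 : ex d 0 0 = m
    · subst h1
      rw [hx]
      simp only [ex_eq_iff, ex0, ex1, ex2]
      rw [if_pos (by simp), if_neg (by omega), if_neg (by omega)]; simp
    by_cases h2 : ex 0 (d - 1) 1 = m
    · subst h2
      rw [hy]
      simp only [ex_eq_iff, ex0, ex1, ex2]
      rw [if_neg (by omega), if_pos (by simp), if_neg (by omega)]; simp
    by_cases h3 : ex 1 0 (d - 1) = m
    · subst h3
      simp only [ex_eq_iff, ex0, ex1, ex2]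
      rw [if_neg (by omega), if_neg (by omega), if_pos (by simp)]; simp
    rw [if_neg h1, if_neg h2, if_neg h3]
    simp only [add_zero]
    by_contra hne
    have hdeg : m 0 + m 1 + m 2 = d := by
      by_contra hdeg
      apply hne
      apply hG.coeff_eq_zero
      rwa [Finsupp.degree_eq_sum, Fin.sum_univ_three]
    rw [ex_eq_iff] at h1 h2 h3
    rcases hs m hne with ⟨hm1, k, hm2⟩ | ⟨hm1, hm2⟩
    · apply h4
      have hk0 : m 2 ≠ 0 := by omega
      have hk1 : 1 ≤ k := by
        rcases Nat.eq_zero_or_pos k with h | h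
        · rw [h] at hm2; simp at hm2; omega
        · exact h
      have hkd : k ≤ ℓ * k := Nat.le_mul_of_pos_left k (by omega)
      have hℓk : ℓ ≤ ℓ * k := Nat.le_mul_of_pos_right ℓ hk1
      have hmd : m 2 ≠ d := by
        intro h
        obtain ⟨q, hq⟩ := hdvd
        have : ℓ ∣ 1 := by
          rw [show 1 = d - (d - 1) by omega]
          exact Nat.dvd_sub ⟨k, by omega⟩ ⟨q, hq⟩
        have := Nat.le_of_dvd one_pos this
        omega
      refine ⟨k, ?_, ?_⟩
      · simp only [Finset.mem_filter, Finset.mem_Icc]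
        omega
      · rw [ex_eq_iff]; omega
    · omega

end NormalForm

section Arith

lemma graph_cases : ∀ f : Fin 3 → Fin 3, ∃ σ : Equiv.Perm (Fin 3),
    (f (σ 0) = σ 0 ∧ f (σ 1) = σ 2 ∧ f (σ 2) = σ 0) ∨
    (f (σ 0) = σ 0 ∧ f (σ 1) = σ 1 ∧ f (σ 2) = σ 2) ∨
    (f (σ 0) = σ 0 ∧ f (σ 1) = σ 1 ∧ f (σ 2) = σ 0) ∨
    (f (σ 0) = σ 0 ∧ f (σ 1) = σ 0 ∧ f (σ 2) = σ 0) ∨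
    (f (σ 0) = σ 0 ∧ f (σ 1) = σ 2 ∧ f (σ 2) = σ 1) ∨
    (f (σ 0) = σ 1 ∧ f (σ 1) = σ 0 ∧ f (σ 2) = σ 0) ∨
    (f (σ 0) = σ 1 ∧ f (σ 1) = σ 2 ∧ f (σ 2) = σ 0) := by
  decide

lemma graph_main {H : Type*} [CommGroup H] (e ℓ : ℕ) (he : 4 ≤ e) (hℓ : 2 ≤ ℓ) (hdvd : ℓ ∣ e)
    (a : Fin 3 → H) (c : H) (f : Fin 3 → Fin 3) (hf : ∀ i, a i ^ e * a (f i) = c)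
    (hn : ∀ M, (∃ s, ∀ i, a i ^ M = s) → ℓ * e ∣ M) :
    ∃ σ : Equiv.Perm (Fin 3), f (σ 0) = σ 0 ∧ f (σ 1) = σ 2 ∧ f (σ 2) = σ 0 := by
  obtain ⟨σ, hσ⟩ := graph_cases f
  have hn' : ∀ M, (∃ s, a (σ 0) ^ M = s ∧ a (σ 1) ^ M = s ∧ a (σ 2) ^ M = s) → ℓ * e ∣ M := by
    rintro M ⟨s, h0, h1, h2⟩
    refine hn M ⟨s, fun i => ?_⟩
    obtain ⟨j, rfl⟩ := σ.surjective i
    fin_cases j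
    · exact h0
    · exact h1
    · exact h2
  have H0 := hf (σ 0)
  have H1 := hf (σ 1)
  have H2 := hf (σ 2)
  generalize hx : a (σ 0) = x at *
  generalize hy : a (σ 1) = y at *
  generalize hz : a (σ 2) = z at *
  obtain ⟨k, rfl⟩ : ∃ k, e = k + 1 := ⟨e - 1, by omega⟩
  have no1 : ∀ r, r ∣ 1 → r < 2 := fun r h => by
    have := Nat.le_of_dvd one_pos h
    omega
  have e1 : ∀ q : ℕ, ℓ * (k + 1) ∣ (k + 1) * q → ℓ ∣ q := by
    intro q h
    rw [mul_comm ℓ] at h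
    exact Nat.dvd_of_mul_dvd_mul_left (by omega) h
  have e2 : ∀ q : ℕ, ℓ * (k + 1) ∣ (k + 1) * q + 1 → False := by
    intro q h
    have h2 : (k + 1) ∣ (k + 1) * q + 1 := (Dvd.intro_left _ rfl).trans h
    have := no1 _ ((Nat.dvd_add_right (Dvd.intro _ rfl)).1 h2)
    omega
  rcases hσ with hσ | hσ | hσ | hσ | hσ | hσ | hσ <;> obtain ⟨g0, g1, g2⟩ := hσ
  · exact ⟨σ, g0, g1, g2⟩
  all_goals exfalso
  all_goals rw [g0] at H0
  all_goals rw [g1] at H1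
  all_goals rw [g2] at H2
  all_goals simp only [hx, hy, hz] at H0 H1 H2
  · refine e2 1 (hn' _ ⟨c, ?_, ?_, ?_⟩)
    · rw [← H0]; simp [pow_succ]
    · rw [← H1]; simp [pow_succ]
    · rw [← H2]; simp [pow_succ]
  · have h := e1 (k + 2) (hn' _ ⟨c ^ (k + 1), ?_, ?_, ?_⟩)
    · have := no1 ℓ ((Nat.dvd_add_right hdvd).1 h)
      omega
    · rw [← H0, mul_comm, pow_mul]; simp [pow_succ]
    · rw [← H1, mul_comm, pow_mul]; simp [pow_succ]
    · rw [pow_mul, eq_mul_inv_of_mul_eq H2, mul_pow, inv_pow, pow_succ x, H0, pow_succ c (k + 1)]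
      simp
  · have h := e1 1 (hn' _ ⟨c * x⁻¹, ?_, ?_, ?_⟩)
    · have := no1 ℓ h
      omega
    · rw [mul_one]; exact eq_mul_inv_of_mul_eq H0
    · rw [mul_one]; exact eq_mul_inv_of_mul_eq H1
    · rw [mul_one]; exact eq_mul_inv_of_mul_eq H2
  · have key : ∀ y z : H, y ^ (k + 1) * z = c → z ^ (k + 1) * y = c → y ^ ((k + 2) * k) = c ^ k := by
      intro y z H1 H2
      have h : y ^ ((k + 2) * k) * y = c ^ k * y := by
        rw [← pow_succ, show (k + 2) * k + 1 = (k + 1) * (k + 1) by ring, pow_mul,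
          eq_mul_inv_of_mul_eq H1, mul_pow, inv_pow, eq_mul_inv_of_mul_eq H2, pow_succ c k, _root_.mul_inv_rev, inv_inv,
          mul_comm y, ← mul_assoc]
        simp
      exact mul_right_cancel h
    have h := hn' ((k + 2) * k) ⟨c ^ k, ?_, key y z H1 H2, key z y H2 H1⟩
    · have h2 : ℓ * (k + 1) ∣ (k + 1) * (k + 1) := Nat.mul_dvd_mul hdvd dvd_rfl
      have h3 : (k + 1) ∣ (k + 2) * k := (Dvd.intro_left _ rfl).trans h
      have h4 : (k + 1) ∣ (k + 2) * k + 1 := ⟨k + 1, by ring⟩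
      have := no1 _ ((Nat.dvd_add_right h3).1 h4)
      omega
    · rw [pow_mul, ← H0]; simp [pow_succ]
  · have hxy : x ^ k = y ^ k := by
      have h : x ^ k * (x * y) = y ^ k * (x * y) := by
        rw [← mul_assoc, ← pow_succ, H0, mul_comm x y, ← mul_assoc, ← pow_succ, H1]
      exact mul_right_cancel h
    have hyz : z ^ (k + 1) = y ^ (k + 1) := by
      rw [eq_mul_inv_of_mul_eq H1, eq_mul_inv_of_mul_eq H2]
    have h := e1 k (hn' _ ⟨y ^ ((k + 1) * k), ?_, rfl, ?_⟩)
    · have := no1 ℓ ((Nat.dvd_add_right h).1 hdvd)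
      omega
    · rw [mul_comm, pow_mul, hxy, ← pow_mul]
    · rw [pow_mul, hyz, ← pow_mul]
  · have key : ∀ x y z : H, x ^ (k + 1) * y = c → y ^ (k + 1) * z = c →
        x ^ ((k + 1) * k + 1) = c ^ k * c⁻¹ * (x * y * z) := by
      intro x y z H0 H1
      have h : x ^ ((k + 1) * k + 1) * x ^ k = c ^ k * z := by
        rw [← pow_add, show (k + 1) * k + 1 + k = (k + 1) * (k + 1) by ring, pow_mul,
          eq_mul_inv_of_mul_eq H0, mul_pow, inv_pow, eq_mul_inv_of_mul_eq H1, pow_succ c k]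
        rw [_root_.mul_inv_rev, inv_inv, mul_comm z, ← mul_assoc]
        simp
      have h' : x ^ k = c * y⁻¹ * x⁻¹ := by
        rw [← H0, pow_succ]; simp
      rw [h', ← eq_mul_inv_iff_mul_eq] at h
      rw [h]
      simp [mul_comm, mul_left_comm, mul_assoc]
    exact e2 k (hn' _ ⟨_, key x y z H0 H1, (key y z x H1 H2).trans (by simp only [mul_comm, mul_left_comm, mul_assoc]),
      (key z x y H2 H0).trans (by simp only [mul_comm, mul_left_comm, mul_assoc])⟩)

end Arith
section Diagonalize

lemma exists_eigenmatrix [IsAlgClosed K] [CharZero K] (A : Matrix (Fin 3) (Fin 3) K) (n : ℕ)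
    (hn : n ≠ 0) (s : K) (hs : s ≠ 0) (hA : A ^ n = Matrix.scalar (Fin 3) s) :
    ∃ (P : Matrix (Fin 3) (Fin 3) K) (a : Fin 3 → K), IsUnit P.det ∧ A * P = P * Matrix.diagonal a := by
  classical
  let T : Module.End K (Fin 3 → K) := Matrix.toLinAlgEquiv' A
  have hss : T.IsSemisimple := by
    apply Module.End.isSemisimple_of_squarefree_aeval_eq_zero
      (p := Polynomial.X ^ n - Polynomial.C s)
    · apply Polynomial.Separable.squarefree
      exact Polynomial.separable_X_pow_sub_C s (Nat.cast_ne_zero.2 hn) hs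
    · have : T ^ n = algebraMap K _ s := by
        rw [← map_pow, hA]
        exact AlgEquiv.commutes Matrix.toLinAlgEquiv' s
      simp [this]
  have htop : ⨆ μ, T.eigenspace μ = ⊤ := hss.iSup_eigenspace_eq_top
  have hinternal : DirectSum.IsInternal (fun μ => T.eigenspace μ) :=
    DirectSum.isInternal_submodule_of_iSupIndep_of_iSup_eq_top T.eigenspaces_iSupIndep htop
  let b0 := hinternal.collectedBasis (fun μ => Module.finBasis K (T.eigenspace μ))
  have hcard : Module.finrank K (Fin 3 → K) = 3 := by simp
  have : Fintype (Σ μ, Fin (Module.finrank K (T.eigenspace μ))) :=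
    FiniteDimensional.fintypeBasisIndex b0
  have hc : Fintype.card (Σ μ, Fin (Module.finrank K (T.eigenspace μ))) = 3 := by
    rw [← Module.finrank_eq_card_basis b0, hcard]
  let ε := Fintype.equivFinOfCardEq hc
  let b := b0.reindex ε
  have hb : ∀ i, A *ᵥ (b i) = (ε.symm i).1 • b i := by
    intro i
    have hm : b0 (ε.symm i) ∈ T.eigenspace (ε.symm i).1 :=
      hinternal.collectedBasis_mem _ _
    rw [Module.End.mem_eigenspace_iff] at hm
    simpa [b, T] using hm
  refine ⟨Matrix.of fun j i => b i j, fun i => (ε.symm i).1, ?_, ?_⟩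
  · have : (Matrix.of fun j i => b i j) = (Pi.basisFun K (Fin 3)).toMatrix b := by
      ext i j
      simp [Module.Basis.toMatrix_apply]
    rw [this]
    have := Module.Basis.invertibleToMatrix (Pi.basisFun K (Fin 3)) b
    exact (Matrix.isUnit_iff_isUnit_det _).1 (isUnit_of_invertible _)
  · ext j i
    have := congrFun (hb i) j
    rw [Matrix.mul_diagonal, Matrix.mul_apply]
    exact this.trans (mul_comm _ _)

end Diagonalize
section Assembly

lemma weights_arith {H : Type*} [CommGroup H] (e ℓ : ℕ) (he : 4 ≤ e) (hℓ : 2 ≤ ℓ)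
    (a : Fin 3 → H) (c : H) (h0 : a 0 ^ e * a 0 = c) (h1 : a 1 ^ e * a 2 = c)
    (h2 : a 2 ^ e * a 0 = c) (hn : ∀ M, (∃ s, ∀ i, a i ^ M = s) → ℓ * e ∣ M)
    (m0 m1 m2 : ℕ) (hm : m0 + m1 + m2 = e + 1) (hw : a 0 ^ m0 * a 1 ^ m1 * a 2 ^ m2 = c) :
    (m1 = 0 ∧ ℓ ∣ m2) ∨ (m1 = e ∧ m2 = 1) := by
  obtain ⟨u, ha1⟩ : ∃ u, a 1 = u * a 0 := ⟨a 1 * (a 0)⁻¹, by simp⟩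
  obtain ⟨w, ha2⟩ : ∃ w, a 2 = w * a 0 := ⟨a 2 * (a 0)⁻¹, by simp⟩
  have huw : u ^ e * w = 1 := by
    rw [ha1, ha2, ← h0, mul_pow, mul_mul_mul_comm] at h1
    exact mul_eq_right.1 h1
  have huw2 : u ^ m1 * w ^ m2 = 1 := by
    rw [ha1, ha2, ← h0, ← pow_succ, ← hm, mul_pow u (a 0) m1,
      mul_pow w (a 0) m2] at hw
    have : (u ^ m1 * w ^ m2) * a 0 ^ (m0 + m1 + m2) = a 0 ^ (m0 + m1 + m2) := by
      refine Eq.trans ?_ hw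
      rw [pow_add, pow_add]
      simp only [mul_comm, mul_left_comm, mul_assoc]
    exact mul_eq_right.1 this
  have hwu : w = (u ^ e)⁻¹ := eq_inv_of_mul_eq_one_right huw
  have hup : u ^ m1 = u ^ (e * m2) := by
    rw [hwu, inv_pow, ← pow_mul] at huw2
    exact mul_inv_eq_one.1 huw2
  have hord : ℓ * e ∣ orderOf u := by
    refine hn _ ⟨a 0 ^ orderOf u, fun i => ?_⟩
    fin_cases i
    · rfl
    · simp only [Fin.mk_one]
      rw [ha1, mul_pow, pow_orderOf_eq_one, one_mul]
    · simp only [Fin.reduceFinMk]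
      rw [ha2, hwu, mul_pow, inv_pow, ← pow_mul, mul_comm e, pow_mul, pow_orderOf_eq_one]
      simp
  have hmod : m1 ≡ e * m2 [MOD ℓ * e] := (pow_eq_pow_iff_modEq.1 hup).of_dvd hord
  have hmode : m1 ≡ e * m2 [MOD e] := hmod.of_dvd (Dvd.intro_left _ rfl)
  have hdv : e ∣ m1 := (hmode.dvd_iff dvd_rfl).2 (Dvd.intro _ rfl)
  obtain ⟨q, rfl⟩ := hdv
  rw [mul_comm ℓ] at hmod
  have hmod' : q ≡ m2 [MOD ℓ] := Nat.ModEq.mul_left_cancel' (by omega) hmod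
  have hq : q = 0 ∨ q = 1 := by
    by_contra hq
    have : e * 2 ≤ e * q := Nat.mul_le_mul_left e (by omega)
    omega
  rcases hq with rfl | rfl
  · left
    exact ⟨by simp, (Nat.modEq_zero_iff_dvd).1 hmod'.symm⟩
  · right
    refine ⟨by simp, ?_⟩
    by_contra hne
    have : m2 = 0 := by omega
    rw [this] at hmod'
    have := Nat.le_of_dvd one_pos ((Nat.modEq_zero_iff_dvd).1 hmod')
    omega

lemma prod_mon {M : Type*} [CommMonoid M] (a : Fin 3 → M) (e : ℕ) (i j : Fin 3) :
    ∏ k, a k ^ (mon e i j k) = a i ^ e * a j := by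
  simp only [mon, Finsupp.add_apply, pow_add, Finset.prod_mul_distrib]
  congr 1
  · rw [Finset.prod_eq_single i] <;> simp +contextual [Finsupp.single_apply, eq_comm]
  · rw [Finset.prod_eq_single j] <;> simp +contextual [Finsupp.single_apply, eq_comm]

lemma subst_perm (σ : Equiv.Perm (Fin 3)) (G : MvPolynomial (Fin 3) K) :
    substPoly ((1 : Matrix (Fin 3) (Fin 3) K).submatrix id σ) G = rename σ.symm G := by
  have h : (fun i => ∑ j, ((1 : Matrix (Fin 3) (Fin 3) K).submatrix id σ) i j •
      (X j : MvPolynomial (Fin 3) K)) = X ∘ σ.symm := by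
    funext i
    rw [Finset.sum_eq_single (σ.symm i)]
    · rw [Matrix.submatrix_apply, id, Equiv.apply_symm_apply, Matrix.one_apply_eq, one_smul]
      rfl
    · intro j _ hj
      rw [Matrix.submatrix_apply, id, Matrix.one_apply_ne, zero_smul]
      rintro rfl
      simp at hj
    · simp
  rw [substPoly, h, rename_eq_aeval]

lemma coeff_perm (σ : Equiv.Perm (Fin 3)) (G : MvPolynomial (Fin 3) K) (e : ℕ) (j k : Fin 3) :
    coeff (mon e j k) (substPoly ((1 : Matrix (Fin 3) (Fin 3) K).submatrix id σ) G) =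
      coeff (mon e (σ j) (σ k)) G := by
  rw [subst_perm, ← coeff_rename_mapDomain σ.symm σ.symm.injective G]
  congr 1
  simp [mon, Finsupp.mapDomain_add, Finsupp.mapDomain_single]

lemma to_nf [IsAlgClosed K] [CharZero K]
    (d ℓ : ℕ) (hd : 5 ≤ d) (hℓ1 : 2 ≤ ℓ) (hdvd : ℓ ∣ d - 1)
    (F : MvPolynomial (Fin 3) K)
    (hhom : F.IsHomogeneous d) (hns : IsNonsingular F)
    (h : ∃ g ∈ projAut F, orderOf g = ℓ * (d - 1)) :
    ∃ Q : GL (Fin 3) K, ∃ α : K, α ≠ 0 ∧ ∃ β : ℕ → K,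
      substPoly (Q : Matrix (Fin 3) (Fin 3) K) F = nf d ℓ α β := by
  obtain ⟨e, rfl⟩ : ∃ e, d = e + 1 := ⟨d - 1, by omega⟩
  simp only [Nat.add_sub_cancel] at *
  obtain ⟨g, hg, hord⟩ := h
  obtain ⟨A, ⟨c, hc⟩, rfl⟩ := hg
  have hcenter : ∀ M, ℓ * e ∣ M ↔
      ∃ s, Matrix.scalar (Fin 3) s = (A : Matrix (Fin 3) (Fin 3) K) ^ M := by
    intro M
    rw [← hord, orderOf_dvd_iff_pow_eq_one, ← map_pow]
    have : QuotientGroup.mk' (Subgroup.center (GL (Fin 3) K)) (A ^ M) = 1 ↔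
        A ^ M ∈ Subgroup.center (GL (Fin 3) K) := QuotientGroup.eq_one_iff _
    rw [this, Matrix.GeneralLinearGroup.mem_center_iff_val_mem_range_scalar]
    rfl
  have hdetA : (A : Matrix (Fin 3) (Fin 3) K).det ≠ 0 :=
    ((Matrix.isUnit_iff_isUnit_det _).1 A.isUnit).ne_zero
  obtain ⟨s, hs⟩ := (hcenter (ℓ * e)).1 dvd_rfl
  have hs0 : s ≠ 0 := by
    rintro rfl
    have := congrArg Matrix.det hs
    rw [map_zero, Matrix.det_pow, Matrix.det_zero] at this
    exact pow_ne_zero _ hdetA this.symm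
  obtain ⟨P, a, hP, hAP⟩ := exists_eigenmatrix (A : Matrix (Fin 3) (Fin 3) K) (ℓ * e)
    (Nat.mul_ne_zero (by omega) (by omega)) s hs0 hs.symm
  have ha : ∀ i, a i ≠ 0 := by
    have := congrArg Matrix.det hAP
    rw [Matrix.det_mul, Matrix.det_mul, Matrix.det_diagonal, mul_comm] at this
    have := mul_left_cancel₀ hP.ne_zero this
    rw [this] at hdetA
    intro i
    exact Finset.prod_ne_zero_iff.1 hdetA i (Finset.mem_univ i)
  let au : Fin 3 → Kˣ := fun i => Units.mk0 (a i) (ha i)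
  have hPow : ∀ M : ℕ, (A : Matrix (Fin 3) (Fin 3) K) ^ M * P = P * Matrix.diagonal (a ^ M) := by
    intro M
    rw [← Matrix.diagonal_pow]
    induction M with
    | zero => simp
    | succ M ih => rw [pow_succ, mul_assoc, hAP, ← mul_assoc, ih, mul_assoc, ← pow_succ]
  have hn : ∀ M, (∃ s, ∀ i, au i ^ M = s) → ℓ * e ∣ M := by
    rintro M ⟨s, hs⟩
    rw [hcenter]
    refine ⟨s, ?_⟩
    have h1 : Matrix.diagonal (a ^ M) = Matrix.scalar (Fin 3) (s : K) := by
      rw [Matrix.scalar_apply]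
      congr 1
      funext i
      rw [← hs i]
      simp [au]
    have h2 := hPow M
    rw [h1, ← (Matrix.scalar_commute (s : K) (fun r => mul_comm _ _) P).eq] at h2
    have hPu : IsUnit P := (Matrix.isUnit_iff_isUnit_det _).2 hP
    exact (hPu.mul_right_cancel h2).symm
  obtain ⟨PU, hPU⟩ : IsUnit P := (Matrix.isUnit_iff_isUnit_det _).2 hP
  have hG0n : IsNonsingular (substPoly P F) := hPU ▸ nonsing_subst PU F hns
  have hG0h : (substPoly P F).IsHomogeneous (e + 1) := homog_subst P F _ hhom
  have hinv : substPoly (Matrix.diagonal a) (substPoly P F) = (c : K) • substPoly P F := by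
    rw [← substPoly_mul, ← hAP, substPoly_mul, hc, substPoly_smul]
  have hwt0 : ∀ m, coeff m (substPoly P F) ≠ 0 → ∏ i, au i ^ m i = c := by
    intro m hm
    have := congrArg (coeff m) hinv
    rw [coeff_subst_diag, coeff_smul, smul_eq_mul] at this
    have := mul_right_cancel₀ hm this
    ext
    simpa [au] using this
  choose f hf using exists_mon _ e hG0h hG0n
  have hrel : ∀ i, au i ^ e * au (f i) = c := fun i => by
    rw [← prod_mon]; exact hwt0 _ (hf i)
  obtain ⟨σ, hσ0, hσ1, hσ2⟩ := graph_main e ℓ (by omega) hℓ1 hdvd au c f hrel hn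
  -- permute the variables
  set S : Matrix (Fin 3) (Fin 3) K := (1 : Matrix (Fin 3) (Fin 3) K).submatrix id σ with hS
  have hSdet : S.det ≠ 0 := by
    rw [hS, Matrix.det_permute']
    simp
  have hSdiag : Matrix.diagonal a * S = S * Matrix.diagonal (a ∘ σ) := by
    ext i j
    rw [Matrix.diagonal_mul, Matrix.mul_diagonal]
    simp only [hS, Matrix.submatrix_apply, id, Matrix.one_apply, Function.comp]
    split_ifs with hij
    · rw [hij]; ring
    · simp
  set G := substPoly S (substPoly P F) with hG
  have hGh : G.IsHomogeneous (e + 1) := homog_subst S _ _ hG0h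
  have hcoef : ∀ i j, coeff (mon e i j) G = coeff (mon e (σ i) (σ j)) (substPoly P F) :=
    fun i j => coeff_perm σ _ e i j
  have hinvG : substPoly (Matrix.diagonal (a ∘ σ)) G = (c : K) • G := by
    rw [hG, ← substPoly_mul, ← hSdiag, substPoly_mul, hinv, substPoly_smul]
  have hwt : ∀ m, coeff m G ≠ 0 → ∏ i, (au ∘ σ) i ^ m i = c := by
    intro m hm
    have := congrArg (coeff m) hinvG
    rw [coeff_subst_diag, coeff_smul, smul_eq_mul] at this
    have := mul_right_cancel₀ hm this
    ext
    simpa [au] using this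
  have hmx : mon e 0 0 = ex (e + 1) 0 0 := by
    ext i; fin_cases i <;> simp [mon, ex]
  have hmy : mon e 1 2 = ex 0 e 1 := by
    ext i; fin_cases i <;> simp [mon, ex]
  have hmz : mon e 2 0 = ex 1 0 e := by
    ext i; fin_cases i <;> simp [mon, ex]
  have hcx : coeff (ex (e + 1) 0 0) G ≠ 0 := by
    rw [← hmx, hcoef]; have := hf (σ 0); rwa [hσ0] at this
  have hcy : coeff (ex 0 e 1) G ≠ 0 := by
    rw [← hmy, hcoef]; have := hf (σ 1); rwa [hσ1] at this
  have hcz : coeff (ex 1 0 e) G ≠ 0 := by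
    rw [← hmz, hcoef]; have := hf (σ 2); rwa [hσ2] at this
  have hn' : ∀ M, (∃ s, ∀ i, (au ∘ σ) i ^ M = s) → ℓ * e ∣ M := by
    rintro M ⟨s, hs⟩
    refine hn M ⟨s, fun i => ?_⟩
    have := hs (σ.symm i)
    simpa using this
  have hsupp : ∀ m, coeff m G ≠ 0 → (m 1 = 0 ∧ ℓ ∣ m 2) ∨ (m 1 = e ∧ m 2 = 1) := by
    intro m hm
    refine weights_arith e ℓ (by omega) hℓ1 (au ∘ σ) c ?_ ?_ ?_ hn' (m 0) (m 1) (m 2) ?_ ?_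
    · rw [← prod_mon]; exact hwt _ (hmx ▸ hcx)
    · rw [← prod_mon]; exact hwt _ (hmy ▸ hcy)
    · rw [← prod_mon]; exact hwt _ (hmz ▸ hcz)
    · by_contra hdeg
      apply hm
      apply hGh.coeff_eq_zero
      rwa [Finsupp.degree_eq_sum, Fin.sum_univ_three]
    · rw [← hwt m hm, Fin.prod_univ_three]
  -- rescale
  obtain ⟨x, hx⟩ := IsAlgClosed.exists_pow_nat_eq (coeff (ex (e + 1) 0 0) G)⁻¹
    (n := e + 1) (by omega)
  obtain ⟨y, hy⟩ := IsAlgClosed.exists_pow_nat_eq (coeff (ex 0 e 1) G)⁻¹ (n := e) (by omega)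
  have hx0 : x ≠ 0 := by
    rintro rfl
    rw [zero_pow (by omega)] at hx
    exact inv_ne_zero hcx hx.symm
  have hy0 : y ≠ 0 := by
    rintro rfl
    rw [zero_pow (by omega)] at hy
    exact inv_ne_zero hcy hy.symm
  set T : Matrix (Fin 3) (Fin 3) K := Matrix.diagonal ![x, y, 1] with hT
  have hTdet : T.det ≠ 0 := by
    rw [hT, Matrix.det_diagonal, Fin.prod_univ_three]
    simp [hx0, hy0]
  have hTc : ∀ m, coeff m (substPoly T G) = x ^ m 0 * y ^ m 1 * coeff m G := by
    intro m
    rw [hT, coeff_subst_diag, Fin.prod_univ_three]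
    simp
  obtain ⟨Q, hQ⟩ : IsUnit (P * S * T) := by
    rw [Matrix.isUnit_iff_isUnit_det, Matrix.det_mul, Matrix.det_mul]
    exact (mul_ne_zero (mul_ne_zero hP.ne_zero hSdet) hTdet).isUnit
  have hQF : substPoly (Q : Matrix (Fin 3) (Fin 3) K) F = substPoly T G := by
    rw [hQ, substPoly_mul, substPoly_mul]
  refine ⟨Q, coeff (ex 1 0 e) (substPoly T G), ?_, _, hQF.trans
    (eq_nf (e + 1) ℓ hd hℓ1 hdvd _ (homog_subst T G _ hGh) ?_ ?_ ?_)⟩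
  · rw [hTc]
    simp [hx0, hcz]
  · intro m hm
    rw [hTc] at hm
    exact hsupp m (right_ne_zero_of_mul hm)
  · rw [hTc]
    simp [hx, hcx]
  · rw [hTc]
    simp [hy, hcy]

/-- the one-parameter group `diag(1, u, u^(-e))` -/
def diagHom (K : Type*) [Field K] (e : ℕ) : Kˣ →* GL (Fin 3) K where
  toFun u := ⟨Matrix.diagonal ![1, u, (((u ^ e)⁻¹ : Kˣ) : K)],
    Matrix.diagonal ![1, ((u⁻¹ : Kˣ) : K), ((u ^ e : Kˣ) : K)],
    by
      rw [Matrix.diagonal_mul_diagonal, ← Matrix.diagonal_one]; congr 1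
      funext i; fin_cases i <;> simp,
    by
      rw [Matrix.diagonal_mul_diagonal, ← Matrix.diagonal_one]; congr 1
      funext i; fin_cases i <;> simp⟩
  map_one' := by
    ext1
    simp only [Units.val_one]
    rw [← Matrix.diagonal_one]; congr 1
    funext i; fin_cases i <;> simp
  map_mul' u v := by
    ext1
    simp only [Units.val_mul]
    rw [Matrix.diagonal_mul_diagonal]; congr 1
    funext i; fin_cases i <;> simp [mul_pow, mul_comm]

lemma cyclic_of_nf [CharZero K] (d ℓ : ℕ) (hd : 5 ≤ d) (F : MvPolynomial (Fin 3) K)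
    (Q : GL (Fin 3) K) (α : K) (hα : α ≠ 0) (β : ℕ → K)
    (hQ : substPoly (Q : Matrix (Fin 3) (Fin 3) K) F = nf d ℓ α β) :
    IsCyclic ↥(projAut F) := by
  obtain ⟨e, rfl⟩ : ∃ e, d = e + 1 := ⟨d - 1, by omega⟩
  let φ : Kˣ →* PGL3 K := (QuotientGroup.mk' (Subgroup.center (GL (Fin 3) K))).comp
    ((MulAut.conj Q).toMonoidHom.comp (diagHom K e))
  have : NeZero (e * e) := ⟨Nat.mul_ne_zero (by omega) (by omega)⟩
  have hcyc : IsCyclic ((rootsOfUnity (e * e) K).map φ) := by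
    have := rootsOfUnity.isCyclic K (e * e)
    exact isCyclic_of_surjective (φ.subgroupMap (rootsOfUnity (e * e) K))
      (φ.subgroupMap_surjective _)
  refine Subgroup.isCyclic_of_le (H' := (rootsOfUnity (e * e) K).map φ) ?_
  rintro _ ⟨A, ⟨c, hc⟩, rfl⟩
  have hQi : substPoly ((Q⁻¹ : GL (Fin 3) K) : Matrix (Fin 3) (Fin 3) K) (nf (e + 1) ℓ α β) = F := by
    rw [← hQ, ← substPoly_mul, ← Units.val_mul, mul_inv_cancel, Units.val_one, substPoly_one]
  have hB : substPoly ((Q⁻¹ * A * Q : GL (Fin 3) K) : Matrix (Fin 3) (Fin 3) K)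
      (nf (e + 1) ℓ α β) = (c : K) • nf (e + 1) ℓ α β := by
    rw [Units.val_mul, Units.val_mul, substPoly_mul, substPoly_mul, hQi, hc, substPoly_smul, hQ]
  obtain ⟨a, b, t, hdiag, h1, h2, h3⟩ := nf_rigid (e + 1) ℓ hd α hα β _ c hB
  simp only [Nat.add_sub_cancel] at h2 h3
  have hc0 : (c : K) ≠ 0 := c.ne_zero
  have ha0 : a ≠ 0 := by
    rintro rfl
    rw [zero_mul] at h3
    exact hc0 h3.symm
  have hb0 : b ≠ 0 := by
    rintro rfl
    rw [zero_pow (by omega), zero_mul] at h2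
    exact hc0 h2.symm
  have ht0 : t ≠ 0 := by
    rintro rfl
    rw [mul_zero] at h2
    exact hc0 h2.symm
  let u : Kˣ := Units.mk0 b hb0 / Units.mk0 a ha0
  have hta : t = a * (((u ^ e)⁻¹ : Kˣ) : K) := by
    have : b ^ e * t = a ^ e * a := by rw [h2, ← pow_succ, h1]
    simp only [u, Units.val_inv_eq_inv_val, Units.val_pow_eq_pow_val, Units.val_div_eq_div_val,
      Units.val_mk0]
    rw [div_pow, inv_div, mul_div_assoc', eq_div_iff (pow_ne_zero e hb0)]
    linear_combination this
  have hta2 : t ^ e = a ^ e := by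
    apply mul_left_cancel₀ ha0
    rw [h3, ← h1]; ring
  refine ⟨u, ?_, ?_⟩
  · change u ∈ rootsOfUnity (e * e) K
    rw [mem_rootsOfUnity, pow_mul]
    rw [hta, mul_pow] at hta2
    have h5 : ((((u ^ e)⁻¹ : Kˣ) : K)) ^ e = 1 := by
      apply mul_left_cancel₀ (pow_ne_zero e ha0)
      rw [hta2, mul_one]
    have h6 : ((u ^ e)⁻¹ : Kˣ) ^ e = 1 := by
      ext; simpa using h5
    rw [inv_pow] at h6
    exact inv_eq_one.1 h6
  · change QuotientGroup.mk' (Subgroup.center (GL (Fin 3) K)) (Q * diagHom K e u * Q⁻¹) =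
      QuotientGroup.mk' (Subgroup.center (GL (Fin 3) K)) A
    refine QuotientGroup.eq.2 ?_
    have hz : Q⁻¹ * A * Q = diagHom K e u * Matrix.GeneralLinearGroup.scalar (Fin 3) (Units.mk0 a ha0) := by
      ext1
      rw [hdiag]
      simp only [Units.val_mul]
      have : ((Matrix.GeneralLinearGroup.scalar (Fin 3) (Units.mk0 a ha0) : GL (Fin 3) K) :
        Matrix (Fin 3) (Fin 3) K) = Matrix.diagonal fun _ => a := rfl
      rw [this]
      change _ = Matrix.diagonal ![1, (u : K), (((u ^ e)⁻¹ : Kˣ) : K)] * _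
      rw [Matrix.diagonal_mul_diagonal]
      congr 1
      funext i
      fin_cases i
      · simp
      · simp [u, ha0]
      · simpa [mul_comm] using hta
    have hcen : Matrix.GeneralLinearGroup.scalar (Fin 3) (Units.mk0 a ha0) ∈
        Subgroup.center (GL (Fin 3) K) := by
      rw [Matrix.GeneralLinearGroup.center_eq_range_scalar]
      exact ⟨_, rfl⟩
    have hA : A = Q * diagHom K e u * Q⁻¹ *
        Matrix.GeneralLinearGroup.scalar (Fin 3) (Units.mk0 a ha0) := by
      have h7 : A = Q * (Q⁻¹ * A * Q) * Q⁻¹ := by group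
      rw [h7, hz]
      have h8 := Subgroup.mem_center_iff.1 hcen Q⁻¹
      simp only [mul_assoc]
      rw [h8]
    rw [hA, inv_mul_cancel_left]
    exact hcen

end Assembly

/-- for `d ≥ 5` and `2 ≤ ℓ ≤ d-1` dividing `d-1`, a nonsingular plane
curve of degree `d` with an automorphism of order `ℓ(d-1)` is projectively equivalent
to `X^d + Y^(d-1)·Z + α·X·Z^(d-1) + Σ_k β_k·X^(d-ℓk)·Z^(ℓk)` (sum over `k ≥ 1` with
`2 ≤ ℓk ≤ d-2`); in particular its automorphism group is cyclic. -/
theorem stmt11 {K : Type*} [Field K] [IsAlgClosed K] [CharZero K]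
    (d ℓ : ℕ) (hd : 5 ≤ d) (hℓ1 : 2 ≤ ℓ) (hℓ2 : ℓ ≤ d - 1) (hdvd : ℓ ∣ d - 1)
    (F : MvPolynomial (Fin 3) K)
    (hhom : F.IsHomogeneous d) (hns : IsNonsingular F)
    (h : ∃ g ∈ projAut F, orderOf g = ℓ * (d - 1)) :
    (∃ α : K, α ≠ 0 ∧ ∃ β : ℕ → K,
      ProjEquiv F (X 0 ^ d + X 1 ^ (d - 1) * X 2 + C α * X 0 * X 2 ^ (d - 1) +
        ∑ k ∈ (Finset.Icc 1 d).filter (fun k => 2 ≤ ℓ * k ∧ ℓ * k ≤ d - 2),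
          C (β k) * X 0 ^ (d - ℓ * k) * X 2 ^ (ℓ * k))) ∧
    IsCyclic ↥(projAut F) := by
  obtain ⟨Q, α, hα, β, hQ⟩ := to_nf d ℓ hd hℓ1 hdvd F hhom hns h
  refine ⟨⟨α, hα, β, Q, 1, ?_⟩, cyclic_of_nf d ℓ hd F Q α hα β hQ⟩
  rw [hQ, Units.val_one, one_smul]
  rfl


end
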